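/- Quotienting preserves trace refinement: for LTSs Δ and Θ, trace(Δ) ⊆ trace(Θ) if and only if trace(Δ/≈) ⊆ trace(Θ/≈), where ≈ is branching bisimilarity and Δ/≈, Θ/≈ are the corresponding quotient transition systems. -/

import Mathlib

/-- A finite (possibly empty) sequence of τ-transitions. -/
def TauSeq {S A : Type*} (tr : S → A → S → Prop) (τ : A) : S → S → Prop :=
  Relation.ReflTransGen (fun s s' => tr s τ s')

/-- `R` is a branching bisimulation on the LTS with transition relation `tr`
and silent action `τ`. -/
def IsBranchingBisim {S A : Type*} (tr : S → A → S → Prop) (τ : A)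
    (R : S → S → Prop) : Prop :=
  (∀ s t, R s t → R t s) ∧
  ∀ s1 s2, R s1 s2 →
    (∀ a s1', tr s1 a s1' → a ≠ τ →
      ∃ l s2', TauSeq tr τ s2 l ∧ tr l a s2' ∧ R s1 l ∧ R s1' s2') ∧
    (∀ s1', tr s1 τ s1' →
      R s1' s2 ∨ ∃ l s2', TauSeq tr τ s2 l ∧ tr l τ s2' ∧ R s1 l ∧ R s1' s2')

/-- Branching bisimilarity: the union of all branching bisimulations. -/
def BBisim {S A : Type*} (tr : S → A → S → Prop) (τ : A) (s t : S) : Prop :=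
  ∃ R, IsBranchingBisim tr τ R ∧ R s t
/-- `HasTrace tr τ s w`: the finite sequence `w` of visible (non-τ) actions is a
trace of state `s`, obtained from a path by omitting τ-actions. -/
inductive HasTrace {S A : Type*} (tr : S → A → S → Prop) (τ : A) : S → List A → Prop
  | nil : ∀ s, HasTrace tr τ s []
  | tau : ∀ {s s' w}, tr s τ s' → HasTrace tr τ s' w → HasTrace tr τ s w
  | vis : ∀ {s a s' w}, tr s a s' → a ≠ τ → HasTrace tr τ s' w → HasTrace tr τ s (a :: w)
/-- The ≈-equivalence class of a state. -/
def cls {S A : Type*} (tr : S → A → S → Prop) (τ : A) (s : S) : Set S :=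
  {t | BBisim tr τ s t}

/-- The transition relation of the quotient transition system `Δ/≈`:
visible transitions between classes are induced by all visible transitions,
while τ-transitions are only induced by τ-steps between non-bisimilar states. -/
def QTrans {S A : Type*} (tr : S → A → S → Prop) (τ : A) :
    Set S → A → Set S → Prop :=
  fun C a C' => ∃ s s', C = cls tr τ s ∧ C' = cls tr τ s' ∧ tr s a s' ∧
    (a = τ → ¬ BBisim tr τ s s')

/-- The relaxed (semi-branching) form of a branching bisimulation, in which a τ-step may be
answered by a sequence of τ-steps ending in a state related to both its source and its target. -/
def IsSemiBranchingBisim {S A : Type*} (tr : S → A → S → Prop) (τ : A)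
    (R : S → S → Prop) : Prop :=
  (∀ s t, R s t → R t s) ∧
  ∀ s t, R s t → ∀ a s', tr s a s' →
    ∃ l t', TauSeq tr τ t l ∧ (tr l a t' ∨ a = τ ∧ l = t') ∧ R s l ∧ R s' t'

/-- The union of all semi-branching bisimulations. -/
def SemiBBisim {S A : Type*} (tr : S → A → S → Prop) (τ : A) (s t : S) : Prop :=
  ∃ R, IsSemiBranchingBisim tr τ R ∧ R s t

section

variable {S A : Type*} {tr : S → A → S → Prop} {τ : A}

theorem IsBranchingBisim.isSemiBranchingBisim {R : S → S → Prop}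
    (h : IsBranchingBisim tr τ R) : IsSemiBranchingBisim tr τ R := by
  refine ⟨h.1, fun s t hst a s' hs => ?_⟩
  by_cases ha : a = τ
  · subst ha
    rcases (h.2 s t hst).2 s' hs with h' | ⟨l, t', hl, ht, h1, h2⟩
    · exact ⟨t, t, .refl, .inr ⟨rfl, rfl⟩, hst, h'⟩
    · exact ⟨l, t', hl, .inl ht, h1, h2⟩
  · obtain ⟨l, t', hl, ht, h1, h2⟩ := (h.2 s t hst).1 a s' hs ha
    exact ⟨l, t', hl, .inl ht, h1, h2⟩

theorem IsSemiBranchingBisim.exists_tauSeq {R : S → S → Prop}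
    (h : IsSemiBranchingBisim tr τ R) {s s' t : S} (hst : R s t) (hs : TauSeq tr τ s s') :
    ∃ t', TauSeq tr τ t t' ∧ R s' t' := by
  induction hs with
  | refl => exact ⟨t, .refl, hst⟩
  | tail _ hstep ih =>
    obtain ⟨u, htu, hu⟩ := ih
    obtain ⟨l, t', hl, hlt, -, h2⟩ := h.2 _ _ hu _ _ hstep
    rcases hlt with hlt | ⟨-, rfl⟩
    · exact ⟨t', (htu.trans hl).tail hlt, h2⟩
    · exact ⟨l, htu.trans hl, h2⟩

theorem IsSemiBranchingBisim.exists_comp {R₁ R₂ : S → S → Prop}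
    (h₁ : IsSemiBranchingBisim tr τ R₁) (h₂ : IsSemiBranchingBisim tr τ R₂) {s t u s' : S} {a : A}
    (hst : R₁ s t) (htu : R₂ t u) (hs : tr s a s') :
    ∃ l u', TauSeq tr τ u l ∧ (tr l a u' ∨ a = τ ∧ l = u') ∧
      Relation.Comp R₁ R₂ s l ∧ Relation.Comp R₁ R₂ s' u' := by
  obtain ⟨l, t', hl, hlt, h1, h2⟩ := h₁.2 _ _ hst _ _ hs
  obtain ⟨m, hm, hlm⟩ := h₂.exists_tauSeq htu hl
  rcases hlt with hlt | ⟨rfl, rfl⟩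
  · obtain ⟨n, u', hn, hnu, h3, h4⟩ := h₂.2 _ _ hlm _ _ hlt
    exact ⟨n, u', hm.trans hn, hnu, ⟨l, h1, h3⟩, ⟨t', h2, h4⟩⟩
  · exact ⟨m, m, hm, .inr ⟨rfl, rfl⟩, ⟨l, h1, hlm⟩, ⟨l, h2, hlm⟩⟩

theorem isSemiBranchingBisim_semiBBisim : IsSemiBranchingBisim tr τ (SemiBBisim tr τ) := by
  refine ⟨fun s t ⟨R, hR, h⟩ => ⟨R, hR, hR.1 _ _ h⟩, fun s t ⟨R, hR, h⟩ a s' hs => ?_⟩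
  obtain ⟨l, t', hl, hlt, h1, h2⟩ := hR.2 _ _ h _ _ hs
  exact ⟨l, t', hl, hlt, ⟨R, hR, h1⟩, ⟨R, hR, h2⟩⟩

theorem SemiBBisim.refl (s : S) : SemiBBisim tr τ s s :=
  ⟨Eq, ⟨fun _ _ h => h.symm, by rintro s _ rfl a s' hs; exact ⟨s, s', .refl, .inl hs, rfl, rfl⟩⟩,
    rfl⟩

theorem SemiBBisim.symm {s t : S} (h : SemiBBisim tr τ s t) : SemiBBisim tr τ t s :=
  isSemiBranchingBisim_semiBBisim.1 _ _ h

theorem SemiBBisim.trans {s t u : S} (h₁ : SemiBBisim tr τ s t) (h₂ : SemiBBisim tr τ t u) :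
    SemiBBisim tr τ s u := by
  refine ⟨Relation.Comp (SemiBBisim tr τ) (SemiBBisim tr τ), ⟨?_, ?_⟩, t, h₁, h₂⟩
  · rintro s u ⟨t, h1, h2⟩
    exact ⟨t, h2.symm, h1.symm⟩
  · rintro s u ⟨t, h1, h2⟩ a s' hs
    exact isSemiBranchingBisim_semiBBisim.exists_comp isSemiBranchingBisim_semiBBisim h1 h2 hs

/-- The stuttering property. -/
theorem SemiBBisim.of_tauSeq {t l t' : S} (h : SemiBBisim tr τ t t') (htl : TauSeq tr τ t l)
    (hlt : TauSeq tr τ l t') : SemiBBisim tr τ t l := by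
  let P : S → S → Prop := fun t l =>
    ∃ t', SemiBBisim tr τ t t' ∧ TauSeq tr τ t l ∧ TauSeq tr τ l t'
  refine ⟨fun x y => SemiBBisim tr τ x y ∨ P x y ∨ P y x, ⟨?_, ?_⟩,
    .inr (.inl ⟨t', h, htl, hlt⟩)⟩
  · rintro x y (h | h | h)
    · exact .inl h.symm
    · exact .inr (.inr h)
    · exact .inr (.inl h)
  · rintro x y (h | ⟨z, h, -, hyz⟩ | ⟨-, -, hyx, -⟩) a x' hx
    · obtain ⟨m, y', hm, hmy, h1, h2⟩ := isSemiBranchingBisim_semiBBisim.2 _ _ h _ _ hx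
      exact ⟨m, y', hm, hmy, .inl h1, .inl h2⟩
    · obtain ⟨m, y', hm, hmy, h1, h2⟩ := isSemiBranchingBisim_semiBBisim.2 _ _ h _ _ hx
      exact ⟨m, y', hyz.trans hm, hmy, .inl h1, .inl h2⟩
    · exact ⟨x, x', hyx, .inl hx, .inl (.refl x), .inl (.refl x')⟩

theorem isBranchingBisim_semiBBisim : IsBranchingBisim tr τ (SemiBBisim tr τ) := by
  refine ⟨fun _ _ h => h.symm, fun s t hst => ⟨fun a s' hs ha => ?_, fun s' hs => ?_⟩⟩
  · obtain ⟨l, t', hl, hlt, h1, h2⟩ := isSemiBranchingBisim_semiBBisim.2 _ _ hst _ _ hs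
    exact ⟨l, t', hl, hlt.resolve_right fun h => ha h.1, h1, h2⟩
  · obtain ⟨l, t', hl, hlt, h1, h2⟩ := isSemiBranchingBisim_semiBBisim.2 _ _ hst _ _ hs
    rcases hlt with hlt | ⟨-, rfl⟩
    · exact .inr ⟨l, t', hl, hlt, h1, h2⟩
    · rcases Relation.ReflTransGen.cases_tail hl with rfl | ⟨m, htm, hml⟩
      · exact .inl h2
      · exact .inr ⟨m, l, htm, hml,
          hst.trans ((hst.symm.trans h1).of_tauSeq htm (.single hml)), h2⟩

theorem bbisim_iff_semiBBisim {s t : S} : BBisim tr τ s t ↔ SemiBBisim tr τ s t :=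
  ⟨fun ⟨R, hR, h⟩ => ⟨R, hR.isSemiBranchingBisim, h⟩, fun h => ⟨_, isBranchingBisim_semiBBisim, h⟩⟩

theorem cls_eq_cls_iff {s t : S} : cls tr τ s = cls tr τ t ↔ BBisim tr τ s t := by
  simp only [cls, Set.ext_iff, Set.mem_ofPred_eq, bbisim_iff_semiBBisim]
  exact ⟨fun h => (h t).2 (.refl t), fun h u => ⟨h.symm.trans, h.trans⟩⟩

theorem HasTrace.of_tauSeq {s t : S} {w : List A} (hst : TauSeq tr τ s t)
    (h : HasTrace tr τ t w) : HasTrace tr τ s w := by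
  induction hst using Relation.ReflTransGen.head_induction_on with
  | refl => exact h
  | head hstep _ ih => exact .tau hstep ih

theorem HasTrace.of_bbisim {s t : S} {w : List A} (h : HasTrace tr τ s w)
    (hst : BBisim tr τ s t) : HasTrace tr τ t w := by
  obtain ⟨R, hR, hst⟩ := hst
  induction h generalizing t with
  | nil => exact .nil t
  | tau hs _ ih =>
    rcases (hR.2 _ _ hst).2 _ hs with h | ⟨l, t', hl, hlt, -, h⟩
    · exact ih h
    · exact .of_tauSeq hl (.tau hlt (ih h))
  | vis hs ha _ ih =>
    obtain ⟨l, t', hl, hlt, -, h⟩ := (hR.2 _ _ hst).1 _ _ hs ha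
    exact .of_tauSeq hl (.vis hlt ha (ih h))

/-- The quotient construction preserves the trace set. -/
theorem hasTrace_qTrans_cls_iff {s : S} {w : List A} :
    HasTrace (QTrans tr τ) τ (cls tr τ s) w ↔ HasTrace tr τ s w := by
  constructor
  · intro h
    generalize hC : cls tr τ s = C at h
    induction h generalizing s with
    | nil => exact .nil s
    | tau hstep _ ih =>
      obtain ⟨t, t', rfl, rfl, ht, -⟩ := hstep
      exact (HasTrace.tau ht (ih rfl)).of_bbisim (cls_eq_cls_iff.1 hC.symm)
    | vis hstep ha _ ih =>
      obtain ⟨t, t', rfl, rfl, ht, -⟩ := hstep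
      exact (HasTrace.vis ht ha (ih rfl)).of_bbisim (cls_eq_cls_iff.1 hC.symm)
  · intro h
    induction h with
    | nil => exact .nil _
    | @tau s s' w hs _ ih =>
      by_cases hb : BBisim tr τ s s'
      · rwa [cls_eq_cls_iff.2 hb]
      · exact .tau ⟨s, s', rfl, rfl, hs, fun _ => hb⟩ ih
    | @vis s a s' w hs ha _ ih =>
      exact .vis ⟨s, s', rfl, rfl, hs, fun h => absurd h ha⟩ ha ih

end

/-- Quotienting preserves trace refinement: `trace(Δ) ⊆ trace(Θ)` iff
`trace(Δ/≈) ⊆ trace(Θ/≈)`. -/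
theorem stmt8 {S1 S2 A : Type*} (τ : A)
    (tr1 : S1 → A → S1 → Prop) (s1 : S1)
    (tr2 : S2 → A → S2 → Prop) (s2 : S2) :
    (∀ w, HasTrace tr1 τ s1 w → HasTrace tr2 τ s2 w) ↔
    (∀ w, HasTrace (QTrans tr1 τ) τ (cls tr1 τ s1) w →
      HasTrace (QTrans tr2 τ) τ (cls tr2 τ s2) w) := by
  simp only [hasTrace_qTrans_cls_iff]
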